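/- Let p be a rational prime with p ≡ 1 (mod 4), and let m, n ≥ 0 be integers. Then the limit as K → ∞ (K running over positive integers) of (1/(2K)) · Σ_{k ∈ ℤ, 0 < |k| ≤ K} A_k(p^m) · A_k(p^n) exists and equals min(m, n) + 1 if m + n is even, and equals 0 if m + n is odd. -/

import Mathlib

noncomputable section

open scoped Classical

open Complex Real Filter Asymptotics MeasureTheory

/-- The norm of an ideal of `ℤ[i]`: the cardinality of the quotient ring. -/
def idealNorm (I : Ideal GaussianInt) : ℕ := Nat.card (GaussianInt ⧸ I)

/-- The angle `θ_𝔞 ∈ [0, π/2)` attached to a nonzero ideal of `ℤ[i]`: the argument of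
the generator lying in the first quadrant. -/
def idealTheta (I : Ideal GaussianInt) : ℝ :=
  if h : ∃ α : GaussianInt, Ideal.span {α} = I ∧
      (GaussianInt.toComplex α).arg ∈ Set.Ico 0 (π / 2)
  then (GaussianInt.toComplex h.choose).arg else 0

/-- The von Mangoldt function on ideals of `ℤ[i]`: `Λ(𝔞) = log N(𝔭)` if `𝔞 = 𝔭^r` is a
power of a nonzero prime ideal `𝔭`, and `Λ(𝔞) = 0` otherwise. -/
def idealLambda (I : Ideal GaussianInt) : ℝ :=
  if h : ∃ P : Ideal GaussianInt, ∃ r : ℕ, P.IsPrime ∧ P ≠ ⊥ ∧ 0 < r ∧ I = P ^ r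
  then Real.log (idealNorm h.choose) else 0

/-- The Hecke coefficient `A_k(n) = ∑_{N(𝔞) = n} e^{4ik θ_𝔞}`, the sum running over
nonzero ideals of `ℤ[i]` of norm `n`. -/
def Acoef (k : ℤ) (n : ℕ) : ℂ :=
  ∑' I : Ideal GaussianInt,
    if I ≠ ⊥ ∧ idealNorm I = n then
      Complex.exp (4 * (k : ℂ) * Complex.I * (idealTheta I : ℂ))
    else 0

/-- The basis `1, i` of `ℤ[i]` over `ℤ`. -/
def gaussianBasis : Module.Basis (Fin 2) ℤ GaussianInt :=
  Module.Basis.ofEquivFun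
    { toFun := fun z => ![z.re, z.im]
      invFun := fun v => ⟨v 0, v 1⟩
      map_add' := fun a b => by ext i; fin_cases i <;> simp
      map_smul' := fun a b => by ext i; fin_cases i <;> simp
      left_inv := fun z => by simp
      right_inv := fun v => by ext i; fin_cases i <;> simp }

theorem algebraNorm_eq_norm (x : GaussianInt) : Algebra.norm ℤ x = x.norm := by
  have hb0 : gaussianBasis 0 = ⟨1, 0⟩ := by simp [gaussianBasis]
  have hb1 : gaussianBasis 1 = ⟨0, 1⟩ := by simp [gaussianBasis]
  have hr : ∀ z, gaussianBasis.repr z = Finsupp.equivFunOnFinite.symm ![z.re, z.im] := fun z => by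
    ext i; fin_cases i <;> simp [gaussianBasis]
  rw [Algebra.norm_eq_matrix_det gaussianBasis, Matrix.det_fin_two]
  simp [Algebra.leftMulMatrix_eq_repr_mul, hb0, hb1, hr, Zsqrtd.norm_def]

instance : Module.Free ℤ GaussianInt := Module.Free.of_basis gaussianBasis

instance : Module.Finite ℤ GaussianInt := Module.Finite.of_basis gaussianBasis

theorem idealNorm_span_singleton (x : GaussianInt) :
    idealNorm (Ideal.span {x}) = x.norm.natAbs := by
  rw [← algebraNorm_eq_norm, ← Ideal.absNorm_span_singleton]
  rfl

/-- The fourth power of `x / |x|`, in the form `(x / conj x) ^ 2`. -/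
def angularChar (x : GaussianInt) : ℂ :=
  (GaussianInt.toComplex x / GaussianInt.toComplex (star x)) ^ 2

theorem angularChar_mul (x y : GaussianInt) :
    angularChar (x * y) = angularChar x * angularChar y := by
  simp only [angularChar, star_mul', map_mul]
  rw [mul_div_mul_comm, mul_pow]

theorem angularChar_pow (x : GaussianInt) (n : ℕ) :
    angularChar (x ^ n) = angularChar x ^ n := by
  simp only [angularChar, star_pow, map_pow]
  rw [← div_pow, ← pow_mul, ← pow_mul, mul_comm]

theorem angularChar_star (x : GaussianInt) : angularChar (star x) = (angularChar x)⁻¹ := by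
  simp only [angularChar, star_star]
  rw [← inv_pow, inv_div]

theorem angularChar_ne_zero {x : GaussianInt} (hx : x ≠ 0) : angularChar x ≠ 0 := by
  simp [angularChar, hx]

theorem angularChar_of_isUnit {x : GaussianInt} (hx : IsUnit x) : angularChar x = 1 := by
  rw [← Zsqrtd.norm_eq_one_iff' (by norm_num), Zsqrtd.norm_def] at hx
  obtain ⟨a, b⟩ := x
  simp only at hx
  have ha : a = 0 ∨ a = 1 ∨ a = -1 := by
    have h1 : a ≤ 1 := by nlinarith [mul_self_nonneg b]
    have h2 : -1 ≤ a := by nlinarith [mul_self_nonneg b]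
    omega
  rcases ha with rfl | rfl | rfl
  · have hb : b ≠ 0 := by rintro rfl; simp at hx
    have hb' : (b : ℂ) ≠ 0 := by exact_mod_cast hb
    simp [angularChar, GaussianInt.toComplex_def', hb']
  all_goals
    have hb : b = 0 := by simpa using hx
    subst hb
    simp [angularChar, GaussianInt.toComplex_def']

theorem exp_arg_eq_angularChar {x : GaussianInt} (hx : x ≠ 0) (k : ℤ) :
    Complex.exp (4 * (k : ℂ) * Complex.I * ((GaussianInt.toComplex x).arg : ℂ)) =
      angularChar x ^ k := by
  have hz : (GaussianInt.toComplex x) ≠ 0 := by simpa using hx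
  rw [angularChar, GaussianInt.toComplex_star]
  generalize GaussianInt.toComplex x = z at *
  have hpol := Complex.norm_mul_exp_arg_mul_I z
  have hn : ((‖z‖ : ℝ) : ℂ) ≠ 0 := by simpa using hz
  have hc : (starRingEnd ℂ) z = (‖z‖ : ℂ) * Complex.exp (-(z.arg * Complex.I)) := by
    conv_lhs => rw [← hpol]
    rw [map_mul, ← Complex.exp_conj]
    simp
  have hq : z / (starRingEnd ℂ) z = Complex.exp (2 * (z.arg * Complex.I)) := by
    rw [hc]
    nth_rewrite 1 [← hpol]
    rw [mul_div_mul_left _ _ hn, ← Complex.exp_sub]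
    congr 1; ring
  rw [hq, ← Complex.exp_nat_mul, ← Complex.exp_int_mul]
  congr 1; push_cast; ring

theorem exists_associated_arg_mem {x : GaussianInt} (hx : x ≠ 0) :
    ∃ y : GaussianInt, Associated x y ∧ (GaussianInt.toComplex y).arg ∈ Set.Ico 0 (π / 2) := by
  have key : ∀ y : GaussianInt, 0 < y.re → 0 ≤ y.im →
      (GaussianInt.toComplex y).arg ∈ Set.Ico 0 (π / 2) := by
    intro y hre him
    refine ⟨Complex.arg_nonneg_iff.2 ?_, Complex.arg_lt_pi_div_two_iff.2 (Or.inl ?_)⟩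
    · rw [← GaussianInt.intCast_im]
      exact_mod_cast him
    · rw [← GaussianInt.intCast_re]
      exact_mod_cast hre
  have hu : IsUnit (⟨0, 1⟩ : GaussianInt) :=
    (Zsqrtd.norm_eq_one_iff' (by norm_num) _).1 (by simp [Zsqrtd.norm_def])
  have hxx : x.re ≠ 0 ∨ x.im ≠ 0 := by
    by_contra! h
    exact hx (Zsqrtd.ext h.1 h.2)
  have hi : Associated x (x * ⟨0, 1⟩) := (associated_mul_unit_right x _ hu)
  by_cases h1 : 0 < x.re ∧ 0 ≤ x.im
  · exact ⟨x, Associated.refl _, key _ h1.1 h1.2⟩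
  by_cases h2 : x.re < 0 ∧ x.im ≤ 0
  · exact ⟨-x, (Associated.refl x).neg_right, key _ (by simpa using h2.1) (by simpa using h2.2)⟩
  by_cases h3 : x.im < 0
  · exact ⟨x * ⟨0, 1⟩, hi, key _ (by simp; omega) (by simp; omega)⟩
  · exact ⟨-(x * ⟨0, 1⟩), hi.neg_right, key _ (by simp; omega) (by simp; omega)⟩

theorem exp_idealTheta {x : GaussianInt} (hx : x ≠ 0) (k : ℤ) :
    Complex.exp (4 * (k : ℂ) * Complex.I * (idealTheta (Ideal.span {x}) : ℂ)) =
      angularChar x ^ k := by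
  have h : ∃ α : GaussianInt, Ideal.span {α} = Ideal.span {x} ∧
      (GaussianInt.toComplex α).arg ∈ Set.Ico 0 (π / 2) := by
    obtain ⟨y, hxy, hy⟩ := exists_associated_arg_mem hx
    exact ⟨y, Ideal.span_singleton_eq_span_singleton.2 hxy.symm, hy⟩
  rw [idealTheta, dif_pos h]
  obtain ⟨u, hu⟩ := (Ideal.span_singleton_eq_span_singleton.1 h.choose_spec.1).symm
  have hne : h.choose ≠ 0 := by
    rw [← hu]
    exact mul_ne_zero hx u.ne_zero
  rw [exp_arg_eq_angularChar hne, ← hu, angularChar_mul, angularChar_of_isUnit u.isUnit, mul_one]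

theorem prime_of_norm_eq_prime {p : ℕ} (hp : p.Prime) {q : GaussianInt} (hq : q.norm = p) :
    Prime q := by
  rw [← irreducible_iff_prime]
  refine ⟨fun h => ?_, fun a b hab => ?_⟩
  · rw [← Zsqrtd.norm_eq_one_iff' (by norm_num), hq] at h
    exact hp.one_lt.ne' (by exact_mod_cast h)
  · have h : p = a.norm.natAbs * b.norm.natAbs := by
      rw [← Int.natAbs_mul, ← Zsqrtd.norm_mul, ← hab, hq, Int.natAbs_natCast]
    rw [← Zsqrtd.norm_eq_one_iff, ← Zsqrtd.norm_eq_one_iff]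
    exact (Nat.irreducible_iff_nat_prime p |>.2 hp).isUnit_or_isUnit h |>.imp
      Nat.isUnit_iff.1 Nat.isUnit_iff.1

theorem not_dvd_star {p : ℕ} (hp : p.Prime) (hp2 : p ≠ 2) {q : GaussianInt} (hq : q.norm = p) :
    ¬ q ∣ star q := by
  intro h
  have hp' : Prime (p : ℤ) := Nat.prime_iff_prime_int.1 hp
  have h2 : q ∣ ((2 * q.re : ℤ) : GaussianInt) := by
    have : ((2 * q.re : ℤ) : GaussianInt) = q + star q := by
      ext <;> simp; ring
    rw [this]
    exact dvd_add dvd_rfl h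
  obtain ⟨c, hc⟩ := h2
  have h3 : (p : ℤ) ∣ (2 * q.re) * (2 * q.re) := by
    rw [← Zsqrtd.norm_intCast (d := -1), hc, Zsqrtd.norm_mul, hq]
    exact dvd_mul_right _ _
  have h4 : (p : ℤ) ∣ q.re := by
    have h5 : (p : ℤ) ∣ 2 * q.re := (hp'.dvd_or_dvd h3).elim id id
    refine (hp'.dvd_or_dvd h5).resolve_left fun h6 => hp2 ?_
    exact (Nat.prime_dvd_prime_iff_eq hp Nat.prime_two).1 (by exact_mod_cast h6)
  rw [Zsqrtd.norm_def] at hq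
  have h7 : (p : ℤ) ∣ q.im := by
    have : (p : ℤ) ∣ q.im * q.im := by
      have e : q.im * q.im = p - q.re * q.re := by linarith
      rw [e]
      exact dvd_sub dvd_rfl (h4.mul_right _)
    exact (hp'.dvd_or_dvd this).elim id id
  obtain ⟨s, hs⟩ := h4
  obtain ⟨t, ht⟩ := h7
  rw [hs, ht] at hq
  refine hp'.not_dvd_one ⟨s * s + t * t, mul_left_cancel₀ hp'.ne_zero ?_⟩
  linarith

theorem angularChar_zpow_ne_one {p : ℕ} (hp : p.Prime) (hp2 : p ≠ 2) {q : GaussianInt}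
    (hq : q.norm = p) {j : ℤ} (hj : j ≠ 0) : angularChar q ^ j ≠ 1 := by
  have hprime := prime_of_norm_eq_prime hp hq
  intro h
  have hnat : angularChar q ^ j.natAbs = 1 := by
    rw [← zpow_natCast]
    rcases Int.natAbs_eq j with hj' | hj'
    · rwa [← hj']
    · rwa [hj', zpow_neg, inv_eq_one] at h
  rw [angularChar, ← pow_mul, div_pow, div_eq_one_iff_eq (by simp [hprime.ne_zero]),
    ← map_pow, ← map_pow, GaussianInt.toComplex_inj] at hnat
  have hd : q ∣ star q ^ (2 * j.natAbs) := hnat ▸ dvd_pow_self q (by omega)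
  exact not_dvd_star hp hp2 hq (hprime.dvd_of_dvd_pow hd)

theorem ideal_norm_eq_prime_pow_iff {p : ℕ} (hp : p.Prime) {q : GaussianInt}
    (hq : q.norm = p) (m : ℕ) (I : Ideal GaussianInt) :
    (I ≠ ⊥ ∧ idealNorm I = p ^ m) ↔
      ∃ a ∈ Finset.range (m + 1), Ideal.span {q ^ a * star q ^ (m - a)} = I := by
  have hq' : (star q).norm = p := by rw [Zsqrtd.norm_conj, hq]
  have hn : ∀ a b : ℕ, (q ^ a * star q ^ b).norm.natAbs = p ^ (a + b) := fun a b => by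
    have hpow : ∀ (x : GaussianInt) (c : ℕ), (x ^ c).norm = x.norm ^ c := fun x c =>
      map_pow Zsqrtd.normMonoidHom x c
    rw [Zsqrtd.norm_mul, hpow, hpow, hq, hq', ← pow_add, Int.natAbs_pow, Int.natAbs_natCast]
  constructor
  · rintro ⟨-, hI⟩
    obtain ⟨x, rfl⟩ := IsPrincipalIdealRing.principal I
    change idealNorm (Ideal.span {x}) = _ at hI
    rw [idealNorm_span_singleton] at hI
    have hx : x ∣ q ^ m * star q ^ m := by
      refine ⟨star x, ?_⟩
      rw [← Zsqrtd.norm_eq_mul_conj, ← mul_pow, ← Zsqrtd.norm_eq_mul_conj, hq,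
        ← GaussianInt.abs_natCast_norm x, hI]
      push_cast
      rfl
    obtain ⟨y, z, hy, hz, rfl⟩ := exists_dvd_and_dvd_of_dvd_mul hx
    obtain ⟨a, -, ha⟩ := (dvd_prime_pow (prime_of_norm_eq_prime hp hq) m).1 hy
    obtain ⟨b, -, hb⟩ := (dvd_prime_pow (prime_of_norm_eq_prime hp hq') m).1 hz
    have hab := ha.mul_mul hb
    rw [Zsqrtd.norm_eq_of_associated (by norm_num) hab, hn] at hI
    have hm := Nat.pow_right_injective hp.two_le hI
    refine ⟨a, by simp; omega, ?_⟩
    rw [show m - a = b by omega]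
    exact Ideal.span_singleton_eq_span_singleton.2 hab.symm
  · rintro ⟨a, ha, rfl⟩
    have hne := (prime_of_norm_eq_prime hp hq).ne_zero
    refine ⟨?_, ?_⟩
    · rw [Ne, Ideal.span_singleton_eq_bot]
      exact mul_ne_zero (pow_ne_zero _ hne) (pow_ne_zero _ (star_ne_zero.2 hne))
    · rw [Finset.mem_range] at ha
      rw [idealNorm_span_singleton, hn, show a + (m - a) = m by omega]

theorem angularChar_pow_mul_star_pow {q : GaussianInt} (hq : q ≠ 0) {a m : ℕ} (ha : a ≤ m) :
    angularChar (q ^ a * star q ^ (m - a)) = angularChar q ^ (2 * (a : ℤ) - m) := by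
  rw [angularChar_mul, angularChar_pow, angularChar_pow, angularChar_star, inv_pow,
    ← zpow_natCast, ← zpow_natCast, ← zpow_neg, ← zpow_add₀ (angularChar_ne_zero hq)]
  congr 1
  omega

theorem Acoef_prime_pow {p : ℕ} (hp : p.Prime) (hp2 : p ≠ 2) {q : GaussianInt}
    (hq : q.norm = p) (k : ℤ) (m : ℕ) :
    Acoef k (p ^ m) =
      ∑ a ∈ Finset.range (m + 1), (angularChar q ^ (2 * (a : ℤ) - m)) ^ k := by
  have hne := (prime_of_norm_eq_prime hp hq).ne_zero
  have hne' : ∀ a b : ℕ, q ^ a * star q ^ b ≠ 0 := fun a b =>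
    mul_ne_zero (pow_ne_zero _ hne) (pow_ne_zero _ (star_ne_zero.2 hne))
  have hinj : Set.InjOn (fun a => Ideal.span {q ^ a * star q ^ (m - a)})
      (Finset.range (m + 1) : Set ℕ) := by
    intro a ha b hb hab
    simp only [Finset.coe_range, Set.mem_Iio] at ha hb
    have h : angularChar q ^ (2 * (a : ℤ) - m) = angularChar q ^ (2 * (b : ℤ) - m) := by
      rw [← angularChar_pow_mul_star_pow hne (by omega),
        ← angularChar_pow_mul_star_pow hne (by omega), ← zpow_one (angularChar _),
        ← exp_idealTheta (hne' _ _), ← zpow_one (angularChar (q ^ b * _)),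
        ← exp_idealTheta (hne' _ _)]
      simp only at hab
      rw [hab]
    by_contra hne_ab
    refine angularChar_zpow_ne_one hp hp2 hq (j := (2 * (a : ℤ) - m) - (2 * (b : ℤ) - m))
      (by omega) ?_
    rw [zpow_sub₀ (angularChar_ne_zero hne), h,
      div_self (zpow_ne_zero _ (angularChar_ne_zero hne))]
  rw [Acoef, tsum_eq_sum
    (s := (Finset.range (m + 1)).image fun a => Ideal.span {q ^ a * star q ^ (m - a)}),
    Finset.sum_image hinj]
  · refine Finset.sum_congr rfl fun a ha => ?_
    rw [if_pos ((ideal_norm_eq_prime_pow_iff hp hq m _).2 ⟨a, ha, rfl⟩),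
      exp_idealTheta (hne' _ _),
      angularChar_pow_mul_star_pow hne (Nat.lt_succ_iff.1 (Finset.mem_range.1 ha))]
  · intro I hI
    rw [if_neg]
    rwa [ideal_norm_eq_prime_pow_iff hp hq, ← Finset.mem_image]

theorem norm_angularChar {x : GaussianInt} (hx : x ≠ 0) : ‖angularChar x‖ = 1 := by
  rw [angularChar, GaussianInt.toComplex_star, norm_pow, norm_div, RCLike.norm_conj,
    div_self (by simpa using hx), one_pow]

theorem Icc_neg_succ_erase_zero (K : ℕ) :
    (Finset.Icc (-((K + 1 : ℕ) : ℤ)) ((K + 1 : ℕ) : ℤ)).erase 0 =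
      insert ((K : ℤ) + 1) (insert (-((K : ℤ) + 1)) ((Finset.Icc (-(K : ℤ)) (K : ℤ)).erase 0)) := by
  ext k
  simp only [Finset.mem_erase, Finset.mem_Icc, Finset.mem_insert]
  omega

theorem sum_zpow_mul_sub_one {z : ℂ} (hz : z ≠ 0) (K : ℕ) :
    (∑ k ∈ (Finset.Icc (-(K : ℤ)) (K : ℤ)).erase 0, z ^ k) * (z - 1) =
      z ^ ((K : ℤ) + 1) - z ^ (-(K : ℤ)) - (z - 1) := by
  induction K with
  | zero => simp
  | succ K ih =>
    rw [Icc_neg_succ_erase_zero, Finset.sum_insert (by simp; omega),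
      Finset.sum_insert (by simp), add_mul, add_mul, ih]
    have e : z ^ (-(K : ℤ)) = z ^ (-((K : ℤ) + 1)) * z := by
      rw [← zpow_add_one₀ hz]; congr 1; ring
    push_cast
    rw [zpow_add_one₀ hz ((K : ℤ) + 1), e]
    ring

theorem tendsto_average_zpow {z : ℂ} (hz : ‖z‖ = 1) :
    Tendsto (fun K : ℕ => (1 / (2 * (K : ℂ))) *
        ∑ k ∈ (Finset.Icc (-(K : ℤ)) (K : ℤ)).erase 0, z ^ k)
      atTop (nhds (if z = 1 then 1 else 0)) := by
  have hz0 : z ≠ 0 := by rintro rfl; simp at hz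
  split_ifs with h
  · subst h
    refine tendsto_const_nhds.congr' ?_
    filter_upwards [eventually_gt_atTop 0] with K hK
    have hcard : ((Finset.Icc (-(K : ℤ)) (K : ℤ)).erase 0).card = 2 * K := by
      rw [Finset.card_erase_of_mem (by simp), Int.card_Icc]
      omega
    have hK' : (K : ℂ) ≠ 0 := by exact_mod_cast hK.ne'
    simp only [one_zpow, Finset.sum_const, hcard, nsmul_eq_mul]
    push_cast
    field_simp
  · have hsub : z - 1 ≠ 0 := sub_ne_zero.2 h
    have h0 : Tendsto (fun K : ℕ => 1 / (2 * (K : ℂ))) atTop (nhds 0) := by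
      have := (tendsto_inv_atTop_nhds_zero_nat (𝕜 := ℂ)).const_mul (1 / 2 : ℂ)
      rw [mul_zero] at this
      refine this.congr fun K => ?_
      rw [one_div, one_div, mul_inv]
    refine h0.zero_mul_isBoundedUnder_le ?_
    refine isBoundedUnder_of ⟨(2 + ‖z - 1‖) / ‖z - 1‖, fun K => ?_⟩
    simp only [Function.comp_apply]
    rw [le_div_iff₀ (norm_pos_iff.2 hsub), ← norm_mul, sum_zpow_mul_sub_one hz0]
    refine (norm_sub_le _ _).trans (add_le_add_left ((norm_sub_le _ _).trans ?_) _)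
    rw [norm_zpow, norm_zpow, hz, one_zpow, one_zpow]
    norm_num

theorem sum_range_indicator_of_le {m n : ℕ} (h : m ≤ n) :
    (∑ a ∈ Finset.range (m + 1), ∑ b ∈ Finset.range (n + 1),
        if (2 * (a : ℤ) - m) + (2 * (b : ℤ) - n) = 0 then (1 : ℂ) else 0) =
      if (m + n) % 2 = 0 then (m : ℂ) + 1 else 0 := by
  split_ifs with hmn
  · rw [Finset.sum_congr rfl (g := fun _ => (1 : ℂ))]
    · simp
    · intro a ha
      rw [Finset.mem_range] at ha
      rw [Finset.sum_eq_single_of_mem ((m + n) / 2 - a) (by simp; omega), if_pos (by omega)]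
      intro b _ hb
      rw [if_neg (by omega)]
  · refine Finset.sum_eq_zero fun a _ => Finset.sum_eq_zero fun b _ => ?_
    rw [if_neg (by omega)]

theorem sum_range_indicator (m n : ℕ) :
    (∑ a ∈ Finset.range (m + 1), ∑ b ∈ Finset.range (n + 1),
        if (2 * (a : ℤ) - m) + (2 * (b : ℤ) - n) = 0 then (1 : ℂ) else 0) =
      if (m + n) % 2 = 0 then ((min m n : ℕ) : ℂ) + 1 else 0 := by
  rcases le_total m n with h | h
  · rw [sum_range_indicator_of_le h, min_eq_left h]
  · rw [Finset.sum_comm, min_eq_right h, add_comm m n, ← sum_range_indicator_of_le h]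
    simp only [add_comm]

/-- Coefficient average at a split prime `p ≡ 1 (mod 4)`:
`⟨A_k(p^m) A_k(p^n)⟩_K → min(m,n) + 1` if `m + n` is even and `→ 0` if `m + n` is odd. -/
theorem coefficient_average_split (p : ℕ) (hp : p.Prime) (hp4 : p % 4 = 1) (m n : ℕ) :
    Tendsto
      (fun K : ℕ =>
        (1 / (2 * (K : ℂ))) *
          ∑ k ∈ (Finset.Icc (-(K : ℤ)) (K : ℤ)).erase 0, Acoef k (p ^ m) * Acoef k (p ^ n))
      atTop
      (nhds (if (m + n) % 2 = 0 then ((min m n : ℕ) : ℂ) + 1 else 0)) := by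
  have hp2 : p ≠ 2 := by rintro rfl; omega
  have : Fact p.Prime := ⟨hp⟩
  obtain ⟨a, b, hab⟩ := Nat.Prime.sq_add_sq (p := p) (by omega)
  let q : GaussianInt := ⟨a, b⟩
  have hq : q.norm = p := by
    rw [Zsqrtd.norm_def, ← hab]
    push_cast
    ring
  have hne := (prime_of_norm_eq_prime hp hq).ne_zero
  have hw : angularChar q ≠ 0 := angularChar_ne_zero hne
  have hlim : ∀ e : ℤ, Tendsto (fun K : ℕ => (1 / (2 * (K : ℂ))) *
      ∑ k ∈ (Finset.Icc (-(K : ℤ)) (K : ℤ)).erase 0, (angularChar q ^ e) ^ k)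
      atTop (nhds (if e = 0 then 1 else 0)) := fun e => by
    have he : angularChar q ^ e = 1 ↔ e = 0 :=
      ⟨fun h => by_contra fun h0 => angularChar_zpow_ne_one hp hp2 hq h0 h,
        fun h => by rw [h, zpow_zero]⟩
    have := tendsto_average_zpow (z := angularChar q ^ e)
      (by rw [norm_zpow, norm_angularChar hne, one_zpow])
    simpa only [he] using this
  rw [← sum_range_indicator]
  refine (tendsto_finsetSum _ fun (a : ℕ) _ => tendsto_finsetSum _ fun (b : ℕ) _ =>
    hlim ((2 * (a : ℤ) - m) + (2 * (b : ℤ) - n))).congr fun K => ?_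
  simp only [← Finset.mul_sum]
  congr 1
  simp only [Acoef_prime_pow hp hp2 hq, Finset.sum_mul_sum, zpow_add₀ hw, mul_zpow,
    Finset.sum_comm (s := Finset.range (n + 1)) (t := Finset.erase _ _)]
  rw [Finset.sum_comm]
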